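/- arXiv:2506.03648 — 2 statements merged into one kernel-verified Lean document; each statement's English description precedes it below -/
import Mathlib

section
/- Let s : ℤ → ℂ satisfy (C1) s(k+5) = s(k) for all k ∈ ℤ, (C2) s(k) = i·(1 + s(k+2)·s(k+3)) for all k ∈ ℤ, and (C3) s(−k) = −conj(s(k)) for all k ∈ ℤ, and suppose s(0) ≠ 0. Then s(1)·(1 + s(2)·s(3)) = conj(s(2)) + i, and consequently |s(1)| = |s(2) − i| / |s(0)|; equivalently, |s(1)|² = (1 − 2·Im s(2) + |s(2)|²) / |s(0)|². -/
/-- For Stokes data `s : ℤ → ℂ` of a real PI solution with `s₀ ≠ 0`: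
`s₁ (1 + s₂ s₃) = conj s₂ + i`, hence `|s₁| = |s₂ - i| / |s₀|`, and equivalently
`|s₁|² = (1 - 2 Im s₂ + |s₂|²)/|s₀|²`. -/
theorem stmt16 (s : ℤ → ℂ)
    (hper : ∀ k : ℤ, s (k + 5) = s k)
    (hcon : ∀ k : ℤ, s k = Complex.I * (1 + s (k + 2) * s (k + 3)))
    (hreal : ∀ k : ℤ, s (-k) = -(starRingEnd ℂ) (s k))
    (h0 : s 0 ≠ 0) :
    s 1 * (1 + s 2 * s 3) = (starRingEnd ℂ) (s 2) + Complex.I ∧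
    ‖s 1‖ = ‖s 2 - Complex.I‖ / ‖s 0‖ ∧
    ‖s 1‖ ^ 2
      = (1 - 2 * (s 2).im + ‖s 2‖ ^ 2) / ‖s 0‖ ^ 2 := by
  have e0 : s 0 = Complex.I * (1 + s 2 * s 3) := by simpa using hcon 0
  have e5 : s 5 = s 0 := by simpa using hper 0
  have e6 : s 6 = s 1 := by simpa using hper 1
  have e3 : s 3 = Complex.I * (1 + s 0 * s 1) := by
    have h := hcon 3
    norm_num at h
    rw [e5, e6] at h
    exact h
  have e3' : s 3 = -(starRingEnd ℂ) (s 2) := by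
    have h := hper (-2)
    norm_num at h
    rw [h]
    exact hreal 2
  have main : s 1 * (1 + s 2 * s 3) = (starRingEnd ℂ) (s 2) + Complex.I := by
    have hI : Complex.I * Complex.I = -1 := Complex.I_mul_I
    have hs : Complex.I * s 0 = -(1 + s 2 * s 3) := by
      linear_combination Complex.I * e0 + (1 + s 2 * s 3) * hI
    linear_combination e3 - e3' + s 1 * hs
  have hn : ‖s 0‖ = ‖1 + s 2 * s 3‖ := by
    rw [e0, norm_mul, Complex.norm_I, one_mul]
  have hc : (starRingEnd ℂ) (s 2) + Complex.I = (starRingEnd ℂ) (s 2 - Complex.I) := by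
    simp
  have hpos : ‖s 0‖ ≠ 0 := norm_ne_zero_iff.mpr h0
  have key : ‖s 1‖ = ‖s 2 - Complex.I‖ / ‖s 0‖ := by
    rw [eq_div_iff hpos, hn, ← norm_mul, main, hc, Complex.norm_conj]
  refine ⟨main, key, ?_⟩
  rw [key, div_pow]
  congr 1
  rw [Complex.sq_norm, Complex.sq_norm, Complex.normSq_apply, Complex.normSq_apply]
  simp
  ring
end

section
/- Let s : ℤ → ℂ satisfy (C1) s(k+5) = s(k) for all k ∈ ℤ, (C2) s(k) = i·(1 + s(k+2)·s(k+3)) for all k ∈ ℤ, and (C3) s(−k) = −conj(s(k)) for all k ∈ ℤ, and suppose s(0) ≠ 0 (equivalently, the real number 1 + s(2)·s(3) is nonzero). Then: (i) if Re(1 + s(2)·s(3)) > 0, then |s(2)| < 1 (so 1 − Im s(2) > 0) and the principal argument satisfies arg s(1) = π/2 + arctan( −Re s(2) / (1 − Im s(2)) ); (ii) if Re(1 + s(2)·s(3)) < 0, then arg s(1) = arg( −conj(s(2)) − i ). -/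
/-- For Stokes data `s : ℤ → ℂ` of a real PI solution with `s₀ ≠ 0`:
(i) if `Re(1 + s₂ s₃) > 0` (oscillatory type) then `|s₂| < 1`, so `1 - Im s₂ > 0`, and
`arg s₁ = π/2 + arctan(-Re s₂ / (1 - Im s₂))`;
(ii) if `Re(1 + s₂ s₃) < 0` (singular type) then `arg s₁ = arg(-conj s₂ - i)`. -/
theorem stmt17 (s : ℤ → ℂ)
    (hper : ∀ k : ℤ, s (k + 5) = s k)
    (hcon : ∀ k : ℤ, s k = Complex.I * (1 + s (k + 2) * s (k + 3)))
    (hreal : ∀ k : ℤ, s (-k) = -(starRingEnd ℂ) (s k))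
    (h0 : s 0 ≠ 0) :
    ((1 + s 2 * s 3).re > 0 →
      ‖s 2‖ < 1 ∧ 1 - (s 2).im > 0 ∧
      Complex.arg (s 1) = Real.pi / 2 + Real.arctan (-(s 2).re / (1 - (s 2).im))) ∧
    ((1 + s 2 * s 3).re < 0 →
      Complex.arg (s 1) = Complex.arg (-(starRingEnd ℂ) (s 2) - Complex.I)) := by
  have h3 : s 3 = -(starRingEnd ℂ) (s 2) := by
    have h := hper (-2)
    rw [hreal 2] at h
    simpa using h
  have h6 : s 6 = s 1 := by simpa using hper 1
  have h5 : s 5 = s 0 := by simpa using hper 0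
  have e0 : s 0 = Complex.I * (1 + s 2 * s 3) := by simpa using hcon 0
  have e3 : s 3 = Complex.I * (1 + s 0 * s 1) := by
    have h := hcon 3
    norm_num at h
    rwa [h5, h6] at h
  have hr : 1 + s 2 * s 3 = (((1 + s 2 * s 3).re : ℝ) : ℂ) := by
    rw [h3]
    apply Complex.ext
    · simp
    · simp; ring
  have hn : (1 + s 2 * s 3).re = 1 - ‖s 2‖ ^ 2 := by
    rw [h3, Complex.sq_norm, Complex.normSq_apply]
    simp; ring
  generalize (1 + s 2 * s 3).re = r at hr hn
  rw [hr] at e0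
  have key : (r : ℂ) * s 1 = (starRingEnd ℂ) (s 2) + Complex.I := by
    rw [e0, h3] at e3
    linear_combination e3 + (r * s 1) * Complex.I_mul_I
  constructor
  · intro hpos
    have hlt : ‖s 2‖ < 1 := by nlinarith [norm_nonneg (s 2)]
    have him : 1 - (s 2).im > 0 := by
      have := (abs_le.mp (Complex.abs_im_le_norm (s 2))).2
      linarith
    refine ⟨hlt, him, ?_⟩
    rw [← Complex.arg_real_mul (s 1) hpos, key]
    set t := -(s 2).re / (1 - (s 2).im) with ht
    have hq : 0 < √(1 + t ^ 2) := Real.sqrt_pos.mpr (by positivity)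
    have hz : (starRingEnd ℂ) (s 2) + Complex.I
        = (((1 - (s 2).im) * √(1 + t ^ 2) : ℝ) : ℂ) *
          (Complex.cos ((Real.pi / 2 + Real.arctan t : ℝ) : ℂ)
            + Complex.sin ((Real.pi / 2 + Real.arctan t : ℝ) : ℂ) * Complex.I) := by
      rw [← Complex.ofReal_cos, ← Complex.ofReal_sin, add_comm (Real.pi / 2),
        Real.cos_add_pi_div_two, Real.sin_add_pi_div_two, Real.sin_arctan, Real.cos_arctan]
      have h1 : (1 - (s 2).im) * √(1 + t ^ 2) * (-(t / √(1 + t ^ 2))) = (s 2).re := by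
        have : (1 - (s 2).im) * t = -(s 2).re := by rw [ht]; field_simp
        field_simp
        linarith
      have h2 : (1 - (s 2).im) * √(1 + t ^ 2) * (1 / √(1 + t ^ 2)) = 1 - (s 2).im := by
        field_simp
      rw [mul_add, ← mul_assoc, ← Complex.ofReal_mul, ← Complex.ofReal_mul, h1, h2]
      apply Complex.ext
      · simp
      · simp; ring
    rw [hz]
    apply Complex.arg_mul_cos_add_sin_mul_I (mul_pos him hq)
    have := Real.neg_pi_div_two_lt_arctan t
    have := Real.arctan_lt_pi_div_two t
    have := Real.pi_pos
    constructor <;> linarith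
  · intro hneg
    rw [← Complex.arg_real_mul (s 1) (neg_pos.mpr hneg)]
    congr 1
    push_cast
    linear_combination -key
end
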